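/- The 5-state 2-symbol Turing machine M with transition table δ(A,0)=(1,R,B), δ(A,1)=(1,L,C), δ(B,0)=(1,R,C), δ(B,1)=(1,R,B), δ(C,0)=(1,R,D), δ(C,1)=(0,L,E), δ(D,0)=(1,L,A), δ(D,1)=(1,L,D), δ(E,0)=(1,R,H), δ(E,1)=(0,L,A), started in state A on the all-blank tape, halts after exactly 47,176,870 steps leaving exactly 4,098 non-blank cells on the tape; consequently S(5,2) ≥ 47,176,870 and Σ(5,2) ≥ 4,098. -/

import Mathlib

/-- Move direction of the tape head. -/
inductive Dir : Type
  | L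
  | R

/-- The head displacement of a direction. -/
def Dir.move : Dir → ℤ
  | Dir.L => -1
  | Dir.R => 1

/-- A Turing machine with `n` states and `k` symbols, in Rado's busy beaver model.
States are `Fin n` (state `A` is `0`, `B` is `1`, ...), symbols are `Fin k` with `0`
the blank symbol. A transition yields the written symbol, the move direction and the
next state, where `none` denotes the halting state `H`. -/
abbrev Machine (n k : ℕ) : Type :=
  Fin n → Fin k → Fin k × Dir × Option (Fin n)

/-- A configuration: current state (`none` = halted), head position, tape. -/
structure Cfg (n k : ℕ) where
  state : Option (Fin n)
  pos : ℤ
  tape : ℤ → Fin k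

/-- One computation step (halted configurations are fixed). -/
def step {n k : ℕ} (M : Machine n k) (c : Cfg n k) : Cfg n k :=
  match c.state with
  | none => c
  | some q =>
      { state := (M q (c.tape c.pos)).2.2
        pos := c.pos + (M q (c.tape c.pos)).2.1.move
        tape := Function.update c.tape c.pos (M q (c.tape c.pos)).1 }

/-- The initial configuration: state `A`, head at cell `0`, all-blank tape. -/
def init (n k : ℕ) [NeZero k] : Cfg n k :=
  { state := if h : 0 < n then some ⟨0, h⟩ else none
    pos := 0
    tape := fun _ => 0 }

/-- `HaltsIn M c t`: started from `c`, the machine `M` halts after exactly `t` steps. -/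
def HaltsIn {n k : ℕ} (M : Machine n k) (c : Cfg n k) (t : ℕ) : Prop :=
  ((step M)^[t] c).state = none ∧ ∀ i < t, ((step M)^[i] c).state ≠ none

/-- The number of non-blank cells of a configuration. -/
noncomputable def sigmaCount {n k : ℕ} [NeZero k] (c : Cfg n k) : ℕ :=
  Set.ncard {i : ℤ | c.tape i ≠ 0}

/-- Rado's condition: every transition into the halting state writes `1` and moves right. -/
def Valid {n k : ℕ} [NeZero k] (M : Machine n k) : Prop :=
  ∀ q a, (M q a).2.2 = none → (M q a).1 = 1 ∧ (M q a).2.1 = Dir.R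

/-- The busy beaver step function `S(n,k)`: the maximum number of steps of a halting
`n`-state `k`-symbol machine started on the all-blank tape. -/
noncomputable def bbS (n k : ℕ) [NeZero k] : ℕ :=
  sSup {t : ℕ | ∃ M : Machine n k, Valid M ∧ HaltsIn M (init n k) t}

/-- The busy beaver score function `Σ(n,k)`: the maximum number of non-blank cells left
by a halting `n`-state `k`-symbol machine started on the all-blank tape. -/
noncomputable def bbSigma (n k : ℕ) [NeZero k] : ℕ :=
  sSup {m : ℕ | ∃ M : Machine n k, Valid M ∧
    ∃ t : ℕ, HaltsIn M (init n k) t ∧ sigmaCount ((step M)^[t] (init n k)) = m}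

/-- Marxen and Buntrock's 5-state 2-symbol champion machine
(states `A,B,C,D,E` are `0,1,2,3,4`; `none` is the halting state `H`). -/
def M : Machine 5 2 :=
  ![![(1, Dir.R, some 1), (1, Dir.L, some 2)],
    ![(1, Dir.R, some 2), (1, Dir.R, some 1)],
    ![(1, Dir.R, some 3), (0, Dir.L, some 4)],
    ![(1, Dir.L, some 0), (1, Dir.L, some 3)],
    ![(1, Dir.R, none), (0, Dir.L, some 0)]]

/-- A configuration relative to the head: state, cells to the left of the head (nearest first),
scanned symbol, cells to the right of the head (nearest first). Cells beyond the lists are blank. -/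
structure Snapshot where
  state : Option (Fin 5)
  left : List (Fin 2)
  head : Fin 2
  right : List (Fin 2)

namespace Snapshot

/-- One step of the machine `M` on snapshots. -/
def next : Snapshot → Snapshot
  | ⟨none, l, a, r⟩ => ⟨none, l, a, r⟩
  | ⟨some q, l, a, r⟩ =>
    match M q a with
    | (b, Dir.L, q') => ⟨q', l.tail, l.headD 0, b :: r⟩
    | (b, Dir.R, q') => ⟨q', b :: l, r.headD 0, r.tail⟩

/-- The snapshot `s` describes the configuration `c`. -/
structure Describes (s : Snapshot) (c : Cfg 5 2) : Prop where
  state : c.state = s.state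
  head : c.tape c.pos = s.head
  left : ∀ i : ℕ, c.tape (c.pos - 1 - i) = s.left.getD i 0
  right : ∀ i : ℕ, c.tape (c.pos + 1 + i) = s.right.getD i 0

theorem Describes.step {s : Snapshot} {c : Cfg 5 2} (h : s.Describes c) :
    s.next.Describes (step M c) := by
  obtain ⟨q, l, a, r⟩ := s
  obtain ⟨q', p, T⟩ := c
  obtain ⟨hq, ha, hl, hr⟩ := h
  simp only at hq ha hl hr
  subst hq
  cases q' with
  | none => exact ⟨rfl, ha, hl, hr⟩
  | some q =>
    rcases hM : M q a with ⟨b, d, q'⟩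
    have hl0 := hl 0
    have hr0 := hr 0
    cases d with
    | L =>
      simp only [next, _root_.step, ha, hM, Dir.move]
      refine ⟨rfl, ?_, fun i => ?_, fun i => ?_⟩
      · simp only
        rw [Function.update_of_ne (by simp)]
        cases l <;> simpa [sub_eq_add_neg] using hl0
      · simp only
        rw [Function.update_of_ne (by lia)]
        have := hl (i + 1)
        rw [show p + -1 - 1 - (i : ℤ) = p - 1 - ((i + 1 : ℕ) : ℤ) by push_cast; ring, this]
        cases l <;> simp
      · cases i with
        | zero => simp
        | succ i =>
          simp only
          rw [Function.update_of_ne (by push_cast; lia)]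
          rw [show p + -1 + 1 + ((i + 1 : ℕ) : ℤ) = p + 1 + i by push_cast; ring, hr i]
          simp
    | R =>
      simp only [next, _root_.step, ha, hM, Dir.move]
      refine ⟨rfl, ?_, fun i => ?_, fun i => ?_⟩
      · simp only
        rw [Function.update_of_ne (by simp)]
        cases r <;> simpa using hr0
      · cases i with
        | zero => simp
        | succ i =>
          simp only
          rw [Function.update_of_ne (by push_cast; lia)]
          rw [show p + 1 - 1 - ((i + 1 : ℕ) : ℤ) = p - 1 - i by push_cast; ring, hl i]
          simp
      · simp only
        rw [Function.update_of_ne (by lia)]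
        have := hr (i + 1)
        rw [show p + 1 + 1 + (i : ℤ) = p + 1 + ((i + 1 : ℕ) : ℤ) by push_cast; ring, this]
        cases r <;> simp

theorem Describes.iterate {s : Snapshot} {c : Cfg 5 2} (h : s.Describes c) (t : ℕ) :
    (next^[t] s).Describes ((_root_.step M)^[t] c) := by
  induction t with
  | zero => exact h
  | succ t ih =>
    rw [Function.iterate_succ_apply', Function.iterate_succ_apply']
    exact ih.step

theorem ncard_getD_ne_zero (l : List (Fin 2)) :
    {i : ℕ | l.getD i 0 ≠ 0}.Finite ∧ {i : ℕ | l.getD i 0 ≠ 0}.ncard = l.count 1 := by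
  induction l with
  | nil => simp
  | cons a l ih =>
    obtain ⟨hfin, hcard⟩ := ih
    have himg : ((· + 1) '' {i : ℕ | l.getD i 0 ≠ 0}).ncard = l.count 1 := by
      rw [Set.ncard_image_of_injective _ (add_left_injective 1), hcard]
    have hzero : (0 : ℕ) ∉ (· + 1) '' {i : ℕ | l.getD i 0 ≠ 0} := by simp
    obtain rfl | rfl : a = 0 ∨ a = 1 := by revert a; decide
    · have hset : {i : ℕ | ((0 : Fin 2) :: l).getD i 0 ≠ 0} =
          (· + 1) '' {i : ℕ | l.getD i 0 ≠ 0} := by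
        ext i
        cases i <;> simp
      rw [hset]
      exact ⟨hfin.image _, by rw [himg]; simp⟩
    · have hset : {i : ℕ | ((1 : Fin 2) :: l).getD i 0 ≠ 0} =
          insert 0 ((· + 1) '' {i : ℕ | l.getD i 0 ≠ 0}) := by
        ext i
        cases i <;> simp
      rw [hset]
      exact ⟨(hfin.image _).insert _, by
        rw [Set.ncard_insert_of_notMem hzero (hfin.image _), himg]; simp⟩

theorem Describes.sigmaCount_eq {s : Snapshot} {c : Cfg 5 2} (h : s.Describes c) :
    sigmaCount c = s.left.count 1 + (s.head :: s.right).count 1 := by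
  obtain ⟨hlf, hlc⟩ := ncard_getD_ne_zero s.left
  obtain ⟨hrf, hrc⟩ := ncard_getD_ne_zero (s.head :: s.right)
  have hright : ∀ i : ℕ, c.tape (c.pos + i) = (s.head :: s.right).getD i 0 := by
    intro i
    cases i with
    | zero => simpa using h.head
    | succ i =>
      have := h.right i
      rw [show c.pos + ((i + 1 : ℕ) : ℤ) = c.pos + 1 + i by push_cast; ring, this]
      simp
  have hset : {i : ℤ | c.tape i ≠ 0} =
      (fun i : ℕ => c.pos - 1 - (i : ℤ)) '' {i : ℕ | s.left.getD i 0 ≠ 0} ∪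
      (fun i : ℕ => c.pos + (i : ℤ)) '' {i : ℕ | (s.head :: s.right).getD i 0 ≠ 0} := by
    ext i
    simp only [← h.left, ← hright, Set.mem_union, Set.mem_image, Set.mem_ofPred_eq]
    constructor
    · intro hi
      rcases lt_or_ge i c.pos with hlt | hge
      · have hj : c.pos - 1 - ((c.pos - 1 - i).toNat : ℤ) = i := by lia
        exact Or.inl ⟨_, by rwa [hj], hj⟩
      · have hj : c.pos + ((i - c.pos).toNat : ℤ) = i := by lia
        exact Or.inr ⟨_, by rwa [hj], hj⟩
    · rintro (⟨j, hj, rfl⟩ | ⟨j, hj, rfl⟩) <;> exact hj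
  rw [sigmaCount, hset, Set.ncard_union_eq ?_ (hlf.image _) (hrf.image _),
    Set.ncard_image_of_injective _ (fun a b hab => by simpa using hab),
    Set.ncard_image_of_injective _ (fun a b hab => by simpa using hab), hlc, hrc]
  rw [Set.disjoint_left]
  rintro _ ⟨a, -, rfl⟩ ⟨b, -, hb⟩
  simp only at hb
  lia

/-- The machine leads from `s` to `s'` in `t` steps. -/
def Reaches (s : Snapshot) (t : ℕ) (s' : Snapshot) : Prop :=
  next^[t] s = s'

theorem Reaches.trans {s₁ s₂ s₃ : Snapshot} {t u : ℕ} (h : s₁.Reaches t s₂)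
    (h' : s₂.Reaches u s₃) : s₁.Reaches (t + u) s₃ := by
  rw [Reaches, Nat.add_comm, Function.iterate_add_apply, h, h']

/-- A block of `n` ones followed by `l`. -/
def ones : ℕ → List (Fin 2) → List (Fin 2)
  | 0, l => l
  | n + 1, l => 1 :: ones n l

/-- A block of `n` copies of `001` followed by `l`. -/
def gaps : ℕ → List (Fin 2) → List (Fin 2)
  | 0, l => l
  | n + 1, l => 0 :: 0 :: 1 :: gaps n l

theorem ones_cons (n : ℕ) (l : List (Fin 2)) : ones n (1 :: l) = ones (n + 1) l := by
  induction n with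
  | zero => rfl
  | succ n ih => rw [ones, ih]; rfl

theorem gaps_cons (n : ℕ) (l : List (Fin 2)) :
    gaps n (0 :: 0 :: 1 :: l) = gaps (n + 1) l := by
  induction n with
  | zero => rfl
  | succ n ih => rw [gaps, ih]; rfl

theorem count_gaps (n : ℕ) (l : List (Fin 2)) : (gaps n l).count 1 = n + l.count 1 := by
  induction n with
  | zero => simp [gaps]
  | succ n ih => simp [gaps, ih]; lia

/-- The machine is in state `A`, scanning the blank just left of all nonblank cells, which
form the word `1ⁿ r`. -/
def start (n : ℕ) (r : List (Fin 2)) : Snapshot :=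
  ⟨some 0, [], 0, ones n r⟩

theorem start_one (n : ℕ) : start n [1] = start (n + 1) [] := by
  rw [start, ones_cons, start]

theorem sweep_right (n : ℕ) (l r : List (Fin 2)) :
    Reaches ⟨some 1, l, 1, ones n (0 :: r)⟩ (n + 1) ⟨some 1, ones (n + 1) l, 0, r⟩ := by
  induction n generalizing l with
  | zero => rfl
  | succ n ih =>
    have h := ih (1 :: l)
    rw [ones_cons] at h
    exact h

theorem sweep_right_nil (n : ℕ) (l : List (Fin 2)) :
    Reaches ⟨some 1, l, 1, ones n []⟩ (n + 1) ⟨some 1, ones (n + 1) l, 0, []⟩ := by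
  induction n generalizing l with
  | zero => rfl
  | succ n ih =>
    have h := ih (1 :: l)
    rw [ones_cons] at h
    exact h

theorem sweep_left (n : ℕ) (r : List (Fin 2)) :
    Reaches ⟨some 3, ones n [], 1, r⟩ (n + 1) ⟨some 3, [], 0, ones (n + 1) r⟩ := by
  induction n generalizing r with
  | zero => rfl
  | succ n ih =>
    have h := ih (1 :: r)
    rw [ones_cons] at h
    exact h

/-- Crossing a block of ones to the right from the start configuration. -/
theorem start_sweep (n : ℕ) (r : List (Fin 2)) :
    Reaches (start n (0 :: r)) (n + 1) ⟨some 1, ones (n + 1) [], 0, r⟩ := by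
  cases n with
  | zero => rfl
  | succ n =>
    have h := sweep_right n [1] r
    rw [ones_cons] at h
    exact h

theorem start_sweep_nil (n : ℕ) :
    Reaches (start n []) (n + 1) ⟨some 1, ones (n + 1) [], 0, []⟩ := by
  cases n with
  | zero => rfl
  | succ n =>
    have h := sweep_right_nil n [1]
    rw [ones_cons] at h
    exact h

/-- One gap is absorbed into the initial block of ones. -/
theorem absorb_gap (m : ℕ) (r : List (Fin 2)) :
    Reaches (start m (0 :: 0 :: 1 :: r)) (2 * m + 8) (start (m + 5) r) := by
  have h₁ := start_sweep m (0 :: 1 :: r)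
  have h₂ : Reaches ⟨some 1, ones (m + 1) [], 0, 0 :: 1 :: r⟩ 2
      ⟨some 3, ones (m + 3) [], 1, r⟩ := rfl
  have h₃ := sweep_left (m + 3) r
  have h₄ : Reaches ⟨some 3, [], 0, ones (m + 4) r⟩ 1 (start (m + 5) r) := rfl
  have h := ((h₁.trans h₂).trans h₃).trans h₄
  rwa [show m + 1 + 2 + (m + 3 + 1) + 1 = 2 * m + 8 by ring] at h

theorem absorb_gaps (k m : ℕ) (r : List (Fin 2)) :
    Reaches (start m (gaps k r)) (5 * k ^ 2 + k * (2 * m + 3)) (start (m + 5 * k) r) := by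
  induction k generalizing m with
  | zero => simp [Reaches, gaps]
  | succ k ih =>
    have h := (absorb_gap m (gaps k r)).trans (ih (m + 5))
    rw [show m + 5 + 5 * k = m + 5 * (k + 1) by ring] at h
    exact h |> cast (by congr 1; ring)

/-- The leftward sweep turns triples of ones into gaps. -/
theorem make_gaps (k : ℕ) (l r : List (Fin 2)) :
    Reaches ⟨some 0, ones (3 * k) l, 1, r⟩ (3 * k) ⟨some 0, l, 1, gaps k r⟩ := by
  induction k generalizing r with
  | zero => rfl
  | succ k ih =>
    have h := ih (0 :: 0 :: 1 :: r)
    rw [gaps_cons] at h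
    exact h

theorem turn_left (n : ℕ) :
    Reaches (start n []) (n + 4) ⟨some 0, ones (n + 2) [], 1, [1]⟩ :=
  (start_sweep_nil n).trans (u := 3) rfl

theorem start_three_mul (k : ℕ) :
    Reaches (start (3 * k) []) (5 * k ^ 2 + 19 * k + 15) (start (5 * k + 6) []) := by
  have h₁ := turn_left (3 * k)
  rw [← ones_cons, ← ones_cons] at h₁
  have h₂ := make_gaps k [1, 1] [1]
  have h₃ : Reaches ⟨some 0, [1, 1], 1, gaps k [1]⟩ 3 (start 0 (gaps (k + 1) [1])) := rfl
  have h₄ := absorb_gaps (k + 1) 0 [1]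
  rw [start_one] at h₄
  have h := ((h₁.trans h₂).trans h₃).trans h₄
  rw [show 0 + 5 * (k + 1) + 1 = 5 * k + 6 by ring] at h
  exact h |> cast (by congr 1; ring)

theorem start_three_mul_add_one (k : ℕ) :
    Reaches (start (3 * k + 1) []) (5 * k ^ 2 + 25 * k + 27) (start (5 * k + 9) []) := by
  have h₁ := turn_left (3 * k + 1)
  have h₂ := make_gaps (k + 1) [] [1]
  have h₃ : Reaches ⟨some 0, [], 1, gaps (k + 1) [1]⟩ 5 (start 3 (gaps (k + 1) [1])) := rfl
  have h₄ := absorb_gaps (k + 1) 3 [1]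
  rw [start_one] at h₄
  have h := ((h₁.trans h₂).trans h₃).trans h₄
  rw [show 3 + 5 * (k + 1) + 1 = 5 * k + 9 by ring] at h
  exact h |> cast (by congr 1; ring)

/-- The run from a block of `3k + 2` ones up to the last step before halting. -/
theorem start_three_mul_add_two (k : ℕ) :
    Reaches (start (3 * k + 2) []) (6 * k + 11)
      ⟨some 4, [], 0, 0 :: 1 :: gaps (k + 1) [1]⟩ := by
  have h₁ := turn_left (3 * k + 2)
  rw [show 3 * k + 2 + 2 = 3 * (k + 1) + 1 by ring, ← ones_cons] at h₁
  have h₂ := make_gaps (k + 1) [1] [1]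
  have h₃ : Reaches ⟨some 0, [1], 1, gaps (k + 1) [1]⟩ 2
      ⟨some 4, [], 0, 0 :: 1 :: gaps (k + 1) [1]⟩ := rfl
  exact (h₁.trans h₂).trans h₃ |> cast (by congr 1; ring)

theorem start_reaches_last :
    Reaches (start 0 []) 47176869 ⟨some 4, [], 0, 0 :: 1 :: gaps 4095 [1]⟩ := by
  have h := start_three_mul 0
  replace h := h.trans (start_three_mul 2)
  replace h := h.trans (start_three_mul_add_one 5)
  replace h := h.trans (start_three_mul_add_one 11)
  replace h := h.trans (start_three_mul_add_one 21)
  replace h := h.trans (start_three_mul 38)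
  replace h := h.trans (start_three_mul_add_one 65)
  replace h := h.trans (start_three_mul_add_one 111)
  replace h := h.trans (start_three_mul 188)
  replace h := h.trans (start_three_mul_add_one 315)
  replace h := h.trans (start_three_mul 528)
  replace h := h.trans (start_three_mul 882)
  replace h := h.trans (start_three_mul 1472)
  replace h := h.trans (start_three_mul_add_one 2455)
  replace h := h.trans (start_three_mul_add_two 4094)
  norm_num only at h
  exact h

theorem next_last (r : List (Fin 2)) :
    next ⟨some 4, [], 0, 0 :: r⟩ = ⟨none, [1], 0, r⟩ := rfl

theorem describes_init : (start 0 []).Describes (init 5 2) :=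
  ⟨rfl, rfl, fun _ => rfl, fun _ => rfl⟩

end Snapshot

instance : Finite Dir :=
  Finite.of_surjective (fun b : Bool => if b then Dir.L else Dir.R) fun d => by
    cases d
    · exact ⟨true, rfl⟩
    · exact ⟨false, rfl⟩

theorem iterate_step_state_eq_none {n k : ℕ} {M : Machine n k} {c : Cfg n k} {t u : ℕ}
    (htu : t ≤ u) (h : ((step M)^[t] c).state = none) : ((step M)^[u] c).state = none := by
  induction u, htu using Nat.le_induction with
  | base => exact h
  | succ u _ ih =>
    rw [Function.iterate_succ_apply', step, ih]
    exact ih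

theorem HaltsIn.unique {n k : ℕ} {M : Machine n k} {c : Cfg n k} {t u : ℕ}
    (ht : HaltsIn M c t) (hu : HaltsIn M c u) : t = u :=
  le_antisymm (not_lt.1 fun h => ht.2 u h hu.1) (not_lt.1 fun h => hu.2 t h ht.1)

theorem finite_haltingTimes (n k : ℕ) [NeZero k] :
    {t : ℕ | ∃ M : Machine n k, Valid M ∧ HaltsIn M (init n k) t}.Finite := by
  have h : (⋃ M : Machine n k, {t : ℕ | HaltsIn M (init n k) t}).Finite :=
    Set.finite_iUnion fun M => Set.Subsingleton.finite fun t ht u hu => ht.unique hu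
  exact h.subset fun t ⟨M, _, ht⟩ => Set.mem_iUnion.2 ⟨M, ht⟩

theorem le_bbS {n k : ℕ} [NeZero k] {M : Machine n k} (hM : Valid M) {t : ℕ}
    (ht : HaltsIn M (init n k) t) : t ≤ bbS n k :=
  le_csSup (finite_haltingTimes n k).bddAbove ⟨M, hM, ht⟩

theorem sigmaCount_le_bbSigma {n k : ℕ} [NeZero k] {M : Machine n k} (hM : Valid M) {t : ℕ}
    (ht : HaltsIn M (init n k) t) :
    sigmaCount ((step M)^[t] (init n k)) ≤ bbSigma n k := by
  refine le_csSup (Set.Finite.bddAbove ?_) ⟨M, hM, t, ht, rfl⟩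
  have h : (⋃ M : Machine n k, (fun t => sigmaCount ((step M)^[t] (init n k))) ''
      {t : ℕ | HaltsIn M (init n k) t}).Finite :=
    Set.finite_iUnion fun M =>
      (Set.Subsingleton.finite fun t ht u hu => ht.unique hu).image _
  exact h.subset fun m ⟨M, _, t, ht, hm⟩ => Set.mem_iUnion.2 ⟨M, t, ht, hm⟩

theorem valid_M : Valid M := by
  intro q a
  fin_cases q <;> fin_cases a <;> simp [M]

/-- Started on the all-blank tape, `M` halts after exactly 47,176,870 steps leaving
exactly 4,098 non-blank cells; hence `S(5,2) ≥ 47,176,870` and `Σ(5,2) ≥ 4,098`. -/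
theorem marxen_buntrock_champion :
    HaltsIn M (init 5 2) 47176870 ∧
    sigmaCount ((step M)^[47176870] (init 5 2)) = 4098 ∧
    47176870 ≤ bbS 5 2 ∧ 4098 ≤ bbSigma 5 2 := by
  have hlast := Snapshot.describes_init.iterate 47176869
  rw [Snapshot.start_reaches_last] at hlast
  have hfinal := hlast.step
  rw [Snapshot.next_last] at hfinal
  rw [← Function.iterate_succ_apply' (step M)] at hfinal
  have hhalt : HaltsIn M (init 5 2) 47176870 := by
    refine ⟨hfinal.state, fun i hi hnone => ?_⟩
    have := iterate_step_state_eq_none (Nat.le_of_lt_succ hi) hnone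
    rw [hlast.state] at this
    exact Option.some_ne_none _ this
  have hcount : sigmaCount ((step M)^[47176870] (init 5 2)) = 4098 := by
    rw [hfinal.sigmaCount_eq]
    simp [Snapshot.count_gaps]
  exact ⟨hhalt, hcount, le_bbS valid_M hhalt, hcount ▸ sigmaCount_le_bbSigma valid_M hhalt⟩
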